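/- arXiv:1909.00838 — 2 statements merged into one kernel-verified Lean document; each statement's English description precedes it below -/
import Mathlib

section
/- Let X be a real 2n×2n matrix such that the matrix Y = -X·J·Xᵀ·J has no zero and no positive real eigenvalues (i.e. no real number t ≥ 0 lies in the spectrum of Y). Then there exists a real skew-Hamiltonian matrix M (i.e. (J·M)ᵀ = -J·M) and a real symplectic matrix S (S·J·Sᵀ = J) such that X = M·D·S, where D is the block diagonal matrix D = [[Iₙ, 0], [0, -Iₙ]]. -/
open Matrix

/-- The standard symplectic form matrix `J = [[0, -I_n], [I_n, 0]]`. -/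
def symplJ (n : ℕ) : Matrix (Fin n ⊕ Fin n) (Fin n ⊕ Fin n) ℝ :=
  Matrix.fromBlocks 0 (-1) 1 0

/-- The block diagonal matrix `D = [[I_n, 0], [0, -I_n]]`. -/
def Dmat (n : ℕ) : Matrix (Fin n ⊕ Fin n) (Fin n ⊕ Fin n) ℝ :=
  Matrix.fromBlocks 1 0 0 (-1)

namespace Polynomial

theorem dvd_pow_card_roots_of_forall_mem_roots {K : Type*} [Field K] {f g : K[X]}
    (hf : f.Splits) (hf0 : f ≠ 0) (h : ∀ z ∈ f.roots, g.eval z = 0) :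
    f ∣ g ^ f.roots.card := by
  have hprod : (f.roots.map fun a => X - C a).prod ∣ (f.roots.map fun _ => g).prod :=
    Multiset.prod_dvd_prod_of_dvd _ _ fun a ha => dvd_iff_isRoot.mpr (h a ha)
  rw [Multiset.map_const', Multiset.prod_replicate] at hprod
  have hunit : IsUnit (C f.leadingCoeff) := isUnit_C.mpr (leadingCoeff_ne_zero.mpr hf0).isUnit
  conv_lhs => rw [hf.eq_prod_roots]
  exact (hunit.mul_left_dvd).mpr hprod

/-- The real polynomial whose coefficients are the real parts of those of `q`. -/
theorem exists_map_ofReal_eq_add_conj (q : ℂ[X]) :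
    ∃ p : ℝ[X], p.map (algebraMap ℝ ℂ) = C (1 / 2) * (q + q.map (starRingEnd ℂ)) := by
  refine ⟨∑ i ∈ q.support, monomial i (q.coeff i).re, ?_⟩
  ext i
  rw [coeff_map, finsetSum_coeff, coeff_C_mul, coeff_add, coeff_map, Complex.add_conj]
  simp only [coeff_monomial, Finset.sum_ite_eq', mem_support_iff]
  split_ifs with h
  · simp
  · simp [not_not.mp h]

/-- Interpolation of conjugation-equivariant data by a real polynomial. -/
theorem exists_real_interpolation (s : Finset ℂ) (f : ℂ → ℂ)
    (hs : ∀ z ∈ s, starRingEnd ℂ z ∈ s)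
    (hf : ∀ z ∈ s, f (starRingEnd ℂ z) = starRingEnd ℂ (f z)) :
    ∃ p : ℝ[X], ∀ z ∈ s, aeval z p = f z := by
  obtain ⟨p, hp⟩ := exists_map_ofReal_eq_add_conj (Lagrange.interpolate s id f)
  have hq : ∀ z ∈ s, (Lagrange.interpolate s id f).eval z = f z := fun z hz =>
    Lagrange.eval_interpolate_at_node (v := id) f (Function.injective_id.injOn) hz
  refine ⟨p, fun z hz => ?_⟩
  rw [← eval_map_algebraMap, hp, eval_mul, eval_C, eval_add, hq z hz]
  have hconj : ((Lagrange.interpolate s id f).map (starRingEnd ℂ)).eval z = f z := by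
    conv_lhs => rw [← Complex.conj_conj z]
    rw [eval_map_apply, hq _ (hs z hz), hf z hz, Complex.conj_conj]
  rw [hconj]
  ring

theorem mem_slitPlane_of_aeval_eq_zero {f : ℝ[X]} (hf : ∀ t ≤ 0, f.eval t ≠ 0) {z : ℂ}
    (hz : aeval z f = 0) : z ∈ Complex.slitPlane := by
  by_contra hmem
  rw [Complex.mem_slitPlane_iff, not_or, not_lt, not_not] at hmem
  have hzre : z = algebraMap ℝ ℂ z.re := Complex.ext (by simp) (by simp [hmem.2])
  rw [hzre, aeval_algebraMap_apply, map_eq_zero, coe_aeval_eq_eval] at hz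
  exact hf _ hmem.1 hz

/-- Modulo a real polynomial without roots in `(-∞, 0]`, `X` is a square up to a nilpotent. -/
theorem exists_dvd_pow_sq_sub_X {f : ℝ[X]} (hf : ∀ t ≤ 0, f.eval t ≠ 0) :
    ∃ (p : ℝ[X]) (k : ℕ), f ∣ (p ^ 2 - X) ^ k := by
  have hf0 : f ≠ 0 := fun h => hf 0 le_rfl (by simp [h])
  have hfm : f.map (algebraMap ℝ ℂ) ≠ 0 := (Polynomial.map_ne_zero_iff
    (algebraMap ℝ ℂ).injective).mpr hf0
  have hroot : ∀ z, z ∈ (f.map (algebraMap ℝ ℂ)).roots ↔ aeval z f = 0 := fun z => by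
    rw [mem_roots hfm, IsRoot, eval_map_algebraMap]
  obtain ⟨p, hp⟩ := exists_real_interpolation (f.map (algebraMap ℝ ℂ)).roots.toFinset
    (fun z => z ^ ((2 : ℕ)⁻¹ : ℂ))
    (fun z hz => by
      rw [Multiset.mem_toFinset, hroot] at hz ⊢
      rw [Polynomial.aeval_conj, hz, map_zero])
    (fun z hz => by
      rw [Multiset.mem_toFinset, hroot] at hz
      rw [Complex.conj_cpow _ _ (Complex.mem_slitPlane_iff_arg.mp
        (mem_slitPlane_of_aeval_eq_zero hf hz)).1, map_inv₀, Complex.conj_natCast])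
  refine ⟨p, (f.map (algebraMap ℝ ℂ)).roots.card, (map_dvd_map' (algebraMap ℝ ℂ)).mp ?_⟩
  rw [Polynomial.map_pow]
  refine dvd_pow_card_roots_of_forall_mem_roots (IsAlgClosed.splits _) hfm fun z hz => ?_
  rw [eval_map_algebraMap, map_sub, map_pow, aeval_X, hp z (Multiset.mem_toFinset.mpr hz),
    Complex.cpow_nat_inv_pow _ two_ne_zero, sub_self]

/-- Modulo a real polynomial without roots in `(-∞, 0]`, `X` is a square. -/
theorem exists_dvd_sq_sub_X {f : ℝ[X]} (hf : ∀ t ≤ 0, f.eval t ≠ 0) :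
    ∃ p : ℝ[X], f ∣ p ^ 2 - X := by
  obtain ⟨p, k, hpk⟩ := exists_dvd_pow_sq_sub_X hf
  have hnil : IsNilpotent (AdjoinRoot.mk f p ^ 2 - AdjoinRoot.mk f X) :=
    ⟨k, by rw [← map_pow, ← map_sub, ← map_pow, AdjoinRoot.mk_eq_zero]; exact hpk⟩
  have hX : IsUnit (AdjoinRoot.mk f X) := by
    obtain ⟨a, b, hab⟩ : IsCoprime X f :=
      (irreducible_X.coprime_iff_not_dvd).mpr fun h => hf 0 le_rfl <| by
        rwa [X_dvd_iff, coeff_zero_eq_eval_zero] at h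
    refine IsUnit.of_mul_eq_one (AdjoinRoot.mk f a) ?_
    rw [mul_comm, ← map_mul, ← map_one (AdjoinRoot.mk f), ← hab, map_add, map_mul _ b,
      AdjoinRoot.mk_self, mul_zero, add_zero]
  have hp : IsUnit (AdjoinRoot.mk f p) := by
    have := hnil.isUnit_add_left_of_commute hX (Commute.all _ _)
    rwa [add_sub_cancel, isUnit_pow_iff two_ne_zero] at this
  have h2 : IsUnit (2 : AdjoinRoot f) := by
    have := (IsUnit.mk0 (2 : ℝ) two_ne_zero).map (algebraMap ℝ (AdjoinRoot f))
    rwa [map_ofNat] at this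
  obtain ⟨r, ⟨-, hr⟩, -⟩ := existsUnique_nilpotent_sub_and_aeval_eq_zero
    (P := X ^ 2 - C (AdjoinRoot.mk f X)) (x := AdjoinRoot.mk f p)
    (by simpa using hnil) (by simpa [one_add_one_eq_two] using h2.mul hp)
  obtain ⟨s, rfl⟩ := AdjoinRoot.mk_surjective r
  refine ⟨s, AdjoinRoot.mk_eq_zero.mp ?_⟩
  simpa using hr

end Polynomial

/-- A real matrix without eigenvalues in `(-∞, 0]` has a square root that is a real polynomial
in it. -/
theorem Matrix.exists_aeval_sq_eq {m : Type*} [Fintype m] [DecidableEq m] {A : Matrix m m ℝ}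
    (hA : ∀ t ≤ 0, t ∉ spectrum ℝ A) :
    ∃ p : Polynomial ℝ, Polynomial.aeval A p ^ 2 = A := by
  obtain ⟨p, q, hpq⟩ := Polynomial.exists_dvd_sq_sub_X (f := A.charpoly) fun t ht h =>
    hA t ht (Matrix.mem_spectrum_iff_isRoot_charpoly.mpr h)
  refine ⟨p, ?_⟩
  have := congrArg (Polynomial.aeval A) hpq
  rwa [map_mul, Matrix.aeval_self_charpoly, zero_mul, map_sub, map_pow, Polynomial.aeval_X,
    sub_eq_zero] at this

theorem SemiconjBy.aeval {R A : Type*} [CommSemiring R] [Semiring A] [Algebra R A] {a x y : A}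
    (h : SemiconjBy a x y) (p : Polynomial R) :
    SemiconjBy a (Polynomial.aeval x p) (Polynomial.aeval y p) := by
  induction p using Polynomial.induction_on' with
  | add p q hp hq => simpa using hp.add_right hq
  | monomial n r =>
    rw [Polynomial.aeval_monomial, Polynomial.aeval_monomial]
    exact SemiconjBy.mul_right (Algebra.commutes r a).symm (h.pow_right n)

theorem Matrix.transpose_aeval {R m : Type*} [CommRing R] [Fintype m] [DecidableEq m]
    (A : Matrix m m R) (p : Polynomial R) :
    (Polynomial.aeval A p)ᵀ = Polynomial.aeval Aᵀ p := by
  induction p using Polynomial.induction_on' with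
  | add p q hp hq => simp [hp, hq]
  | monomial n r =>
    simp [Polynomial.aeval_monomial, ← Algebra.smul_def, Matrix.transpose_pow]

theorem symplJ_mul_self (n : ℕ) : symplJ n * symplJ n = -1 := by
  simp [symplJ, Matrix.fromBlocks_multiply, ← Matrix.fromBlocks_one, Matrix.fromBlocks_neg]

theorem transpose_symplJ (n : ℕ) : (symplJ n)ᵀ = -symplJ n := by
  simp [symplJ, Matrix.fromBlocks_transpose, Matrix.fromBlocks_neg]

theorem Dmat_mul_symplJ_mul_transpose (n : ℕ) :
    Dmat n * symplJ n * (Dmat n)ᵀ = -symplJ n := by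
  simp [Dmat, symplJ, Matrix.fromBlocks_multiply, Matrix.fromBlocks_transpose,
    Matrix.fromBlocks_neg]

theorem Dmat_mul_self (n : ℕ) : Dmat n * Dmat n = 1 := by
  simp [Dmat, Matrix.fromBlocks_multiply]

/-- Corollary: if `Y = -X*J*X^T*J` has no real eigenvalue `t ≥ 0`, then `X = M * D * S` with `M` skew-Hamiltonian and `S` symplectic. -/
theorem stmt_7 (n : ℕ) (X : Matrix (Fin n ⊕ Fin n) (Fin n ⊕ Fin n) ℝ)
    (hY : ∀ t : ℝ, t ≥ 0 → t ∉ spectrum ℝ (-(X * symplJ n * Xᵀ * symplJ n))) :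
    ∃ M S : Matrix (Fin n ⊕ Fin n) (Fin n ⊕ Fin n) ℝ,
      (symplJ n * M)ᵀ = -(symplJ n * M) ∧
      S * symplJ n * Sᵀ = symplJ n ∧ X = M * Dmat n * S := by
  have hD := Dmat_mul_symplJ_mul_transpose n
  have hDD := Dmat_mul_self n
  have hJJ := symplJ_mul_self n
  have hJt := transpose_symplJ n
  set J := symplJ n
  set D := Dmat n
  set W := X * J * Xᵀ * J with hW
  have hspec : ∀ t ≤ 0, t ∉ spectrum ℝ W := fun t ht h =>
    hY (-t) (neg_nonneg.mpr ht) (by rwa [← spectrum.neg_eq, Set.neg_mem_neg])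
  have hWunit : IsUnit W := (spectrum.zero_notMem_iff ℝ).mp (hspec 0 le_rfl)
  obtain ⟨p, hp⟩ := Matrix.exists_aeval_sq_eq hspec
  have hWt : SemiconjBy J W Wᵀ := by
    simp [SemiconjBy, hW, hJt, Matrix.transpose_mul, Matrix.mul_assoc]
  have hJM := hWt.aeval p
  rw [← Matrix.transpose_aeval] at hJM
  set M := Polynomial.aeval W p
  have hMt : J * Mᵀ = M * J := by
    have h : J * (J * M) * J = J * (Mᵀ * J) * J := by rw [hJM.eq]
    have h1 : J * (J * M) * J = -(M * J) := by
      rw [← Matrix.mul_assoc J J M, hJJ]; simp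
    have h2 : J * (Mᵀ * J) * J = -(J * Mᵀ) := by
      rw [Matrix.mul_assoc, Matrix.mul_assoc Mᵀ, hJJ]; simp
    rw [h1, h2] at h
    exact (neg_injective h).symm
  have hMunit : IsUnit M := by rwa [← isUnit_pow_iff two_ne_zero, hp]
  have hM : M * M⁻¹ = 1 := M.mul_nonsing_inv ((M.isUnit_iff_isUnit_det).mp hMunit)
  have hM' : M⁻¹ * M = 1 := M.nonsing_inv_mul ((M.isUnit_iff_isUnit_det).mp hMunit)
  have hMtinv : Mᵀ * M⁻¹ᵀ = 1 := by rw [← Matrix.transpose_mul, hM', Matrix.transpose_one]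
  have hK : X * J * Xᵀ = -(M * J * Mᵀ) := by
    rw [Matrix.mul_assoc M, hMt, ← Matrix.mul_assoc, ← sq, hp, hW,
      Matrix.mul_assoc _ J J, hJJ]
    simp
  refine ⟨M, D * M⁻¹ * X, ?_, ?_, ?_⟩
  · rw [Matrix.transpose_mul, hJt, Matrix.mul_neg, ← hJM.eq]
  · calc D * M⁻¹ * X * J * (D * M⁻¹ * X)ᵀ
        = D * M⁻¹ * (X * J * Xᵀ) * M⁻¹ᵀ * Dᵀ := by
          simp only [Matrix.transpose_mul, Matrix.mul_assoc]
      _ = -(D * (M⁻¹ * M) * J * (Mᵀ * M⁻¹ᵀ) * Dᵀ) := by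
          rw [hK]; simp only [Matrix.mul_assoc, Matrix.mul_neg, Matrix.neg_mul]
      _ = J := by rw [hM', hMtinv, Matrix.mul_one, Matrix.mul_one, hD, neg_neg]
  · rw [← Matrix.mul_assoc, ← Matrix.mul_assoc, Matrix.mul_assoc M, hDD, Matrix.mul_one, hM,
      Matrix.one_mul]
end

section
/- Let X be a real 2n×2n matrix such that the matrix Y = -Xᵀ·J·X·J has no zero and no negative real eigenvalues (i.e. no real number t ≤ 0 lies in the spectrum of Y). Then there exists a real skew-Hamiltonian matrix M (i.e. (J·M)ᵀ = -J·M) and a real symplectic matrix S (S·J·Sᵀ = J) such that X = S·M. -/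
open Matrix

open Polynomial in
/-- A complex number that is not a nonpositive real has a square root that is a value of a real
polynomial at that number. -/
lemma exists_aeval_sq_eq_self (z : ℂ) (hz : ∀ t : ℝ, t ≤ 0 → z ≠ t) :
    ∃ p : ℝ[X], aeval z p ^ 2 = z := by
  by_cases him : z.im = 0
  · have hre : z = (z.re : ℂ) := Complex.ext rfl (by simpa using him)
    have hpos : 0 ≤ z.re := by
      by_contra! h
      exact hz z.re h.le hre
    refine ⟨C (Real.sqrt z.re), ?_⟩
    rw [aeval_C, Complex.coe_algebraMap, ← Complex.ofReal_pow, Real.sq_sqrt hpos, ← hre]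
  · obtain ⟨w, hw⟩ := IsAlgClosed.exists_pow_nat_eq z (n := 2) (by norm_num)
    refine ⟨C (w.im / z.im) * X + C (w.re - w.im / z.im * z.re), ?_⟩
    have hval : aeval z (C (w.im / z.im) * X + C (w.re - w.im / z.im * z.re)) = w := by
      apply Complex.ext
      · simp [-Complex.ofReal_div]
      · simp [-Complex.ofReal_div, him]
    rw [hval, hw]

open Polynomial in
/-- An irreducible real polynomial without nonpositive roots divides `p ^ 2 - X` for some `p`. -/
lemma exists_dvd_sq_sub_X_of_irreducible {r : ℝ[X]} (hr : Irreducible r)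
    (hroot : ∀ t : ℝ, t ≤ 0 → ¬ r.IsRoot t) : ∃ p : ℝ[X], r ∣ p ^ 2 - X := by
  obtain ⟨z, hz⟩ := IsAlgClosed.exists_aeval_eq_zero ℂ r hr.degree_pos.ne'
  obtain ⟨p, hp⟩ := exists_aeval_sq_eq_self z (by
    rintro t ht rfl
    refine hroot t ht ?_
    rw [← Complex.coe_algebraMap, aeval_algebraMap_apply, Complex.coe_algebraMap] at hz
    simpa [IsRoot] using hz)
  refine ⟨p, ?_⟩
  have hassoc : r ∣ minpoly ℝ z :=
    ((minpoly.irreducible (IsIntegral.of_finite ℝ z)).associated_of_dvd hr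
      (minpoly.dvd ℝ z hz)).symm.dvd
  exact hassoc.trans (minpoly.dvd ℝ z (by simp [hp]))

open Polynomial in
/-- Hensel lifting of a square root of `X` from an irreducible real polynomial to its powers. -/
lemma exists_pow_dvd_sq_sub_X {r : ℝ[X]} (hr : Irreducible r)
    (hroot : ∀ t : ℝ, t ≤ 0 → ¬ r.IsRoot t) (k : ℕ) : ∃ p : ℝ[X], r ^ (k + 1) ∣ p ^ 2 - X := by
  induction k with
  | zero => simpa using exists_dvd_sq_sub_X_of_irreducible hr hroot
  | succ k ih =>
    obtain ⟨p, c, hc⟩ := ih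
    have hrp : IsCoprime r p := by
      refine (hr.coprime_iff_not_dvd).2 fun hdvd ↦ hroot 0 le_rfl ?_
      have hX : r ∣ X := by
        have h : r ∣ p ^ 2 - X := ⟨r ^ k * c, by rw [hc]; ring⟩
        have := dvd_sub (dvd_pow hdvd two_ne_zero) h
        simpa using this
      have : Associated r X := hr.associated_of_dvd irreducible_X hX
      exact dvd_iff_isRoot.1 (by simpa using this.symm.dvd)
    obtain ⟨a, b, hab⟩ := hrp
    refine ⟨p - C (1 / 2) * b * c * r ^ (k + 1), a * c + C (1 / 4) * b ^ 2 * c ^ 2 * r ^ k, ?_⟩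
    have h2 : (C (1 / 2) : ℝ[X]) * 2 = 1 := by
      rw [← C_ofNat, ← C_mul]; norm_num
    have h4 : (C (1 / 4) : ℝ[X]) = C (1 / 2) ^ 2 := by
      rw [← C_pow]; norm_num
    rw [h4]
    linear_combination hc - p * b * c * r ^ (k + 1) * h2 - c * r ^ (k + 1) * hab

open Polynomial in
/-- `X` is a square modulo every nonzero real polynomial without nonpositive roots. -/
lemma exists_dvd_sq_sub_X (q : ℝ[X]) (hq : q ≠ 0) (hroot : ∀ t : ℝ, t ≤ 0 → ¬ q.IsRoot t) :
    ∃ p : ℝ[X], q ∣ p ^ 2 - X := by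
  induction q using UniqueFactorizationMonoid.induction_on_coprime with
  | h0 => exact absurd rfl hq
  | h1 hu => exact ⟨0, hu.dvd⟩
  | hpr k hr =>
    rename_i r
    cases k with
    | zero => exact ⟨0, by simp⟩
    | succ k =>
      exact exists_pow_dvd_sq_sub_X hr.irreducible
        (fun t ht h ↦ hroot t ht (h.dvd (dvd_pow_self r k.succ_ne_zero))) k
  | hcp hrel hx hy =>
    rename_i x y
    obtain ⟨p₁, h₁⟩ := hx (left_ne_zero_of_mul hq)
      fun t ht h ↦ hroot t ht (h.dvd (dvd_mul_right x y))
    obtain ⟨p₂, h₂⟩ := hy (right_ne_zero_of_mul hq)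
      fun t ht h ↦ hroot t ht (h.dvd (dvd_mul_left y x))
    have hco : IsCoprime x y := hrel.isCoprime
    obtain ⟨a, b, hab⟩ := id hco
    obtain ⟨c₁, hc₁⟩ := h₁
    obtain ⟨c₂, hc₂⟩ := h₂
    refine ⟨p₁ + a * x * (p₂ - p₁), hco.mul_dvd ?_ ?_⟩
    · exact ⟨c₁ + 2 * p₁ * a * (p₂ - p₁) + a ^ 2 * x * (p₂ - p₁) ^ 2, by
        linear_combination hc₁⟩
    · have : p₁ + a * x * (p₂ - p₁) = p₂ + b * y * (p₁ - p₂) := by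
        linear_combination (p₂ - p₁) * hab
      rw [this]
      exact ⟨c₂ + 2 * p₂ * b * (p₁ - p₂) + b ^ 2 * y * (p₁ - p₂) ^ 2, by
        linear_combination hc₂⟩

/-- A real matrix without nonpositive eigenvalues has a square root that is a polynomial in it. -/
lemma Matrix.exists_aeval_sq_eq_self {m : Type*} [Fintype m] [DecidableEq m] (A : Matrix m m ℝ)
    (hA : ∀ t : ℝ, t ≤ 0 → ¬ A.charpoly.IsRoot t) :
    ∃ p : Polynomial ℝ, Polynomial.aeval A p ^ 2 = A := by
  obtain ⟨p, c, hc⟩ := exists_dvd_sq_sub_X A.charpoly A.charpoly_monic.ne_zero hA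
  refine ⟨p, ?_⟩
  have h := congrArg (Polynomial.aeval A) hc
  rw [map_mul, Matrix.aeval_self_charpoly, zero_mul] at h
  simpa [sub_eq_zero] using h

/-- If `A` is self-adjoint for the bilinear form `K`, then so is every polynomial in `A`. -/
lemma Matrix.transpose_aeval_mul_eq {m : Type*} [Fintype m] [DecidableEq m] {A K : Matrix m m ℝ}
    (h : Aᵀ * K = K * A) (p : Polynomial ℝ) :
    (Polynomial.aeval A p)ᵀ * K = K * Polynomial.aeval A p := by
  induction p using Polynomial.induction_on' with
  | add p q hp hq => simp [add_mul, mul_add, hp, hq]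
  | monomial k a =>
    have hk : (A ^ k)ᵀ * K = K * A ^ k := by
      rw [transpose_pow]
      exact ((show SemiconjBy K A Aᵀ from h.symm).pow_right k).eq.symm
    rw [Polynomial.aeval_monomial, ← Algebra.smul_def, transpose_smul, smul_mul_assoc, hk,
      mul_smul_comm]

/-- Corollary: if `Y = -X^T*J*X*J` has no real eigenvalue `t ≤ 0`, then `X = S * M` with `M` skew-Hamiltonian and `S` symplectic. -/
theorem stmt_9 (n : ℕ) (X : Matrix (Fin n ⊕ Fin n) (Fin n ⊕ Fin n) ℝ)
    (hY : ∀ t : ℝ, t ≤ 0 → t ∉ spectrum ℝ (-(Xᵀ * symplJ n * X * symplJ n))) :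
    ∃ M S : Matrix (Fin n ⊕ Fin n) (Fin n ⊕ Fin n) ℝ,
      (symplJ n * M)ᵀ = -(symplJ n * M) ∧
      S * symplJ n * Sᵀ = symplJ n ∧ X = S * M := by
  have hJ : symplJ n = Matrix.J (Fin n) ℝ := rfl
  rw [hJ] at hY ⊢
  set K := Matrix.J (Fin n) ℝ
  have hKK : K * K = -1 := Matrix.J_squared (Fin n) ℝ
  have hKT : Kᵀ = -K := Matrix.J_transpose (Fin n) ℝ
  set A := K * -(Xᵀ * K * X) with hA
  have hKA : K * A = Xᵀ * K * X := by
    rw [hA, ← mul_assoc, hKK, neg_one_mul, neg_neg]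
  have hself : Aᵀ * K = K * A := by
    rw [hKA, hA]
    simp only [transpose_mul, transpose_neg, transpose_transpose, hKT]
    simp [mul_assoc, hKK]
  have hroot : ∀ t : ℝ, t ≤ 0 → ¬ A.charpoly.IsRoot t := by
    intro t ht h
    rw [hA, Matrix.charpoly_mul_comm, neg_mul] at h
    exact hY t ht (Matrix.mem_spectrum_iff_isRoot_charpoly.2 h)
  obtain ⟨p, hp⟩ := A.exists_aeval_sq_eq_self hroot
  have hMK := Matrix.transpose_aeval_mul_eq hself p
  set M := Polynomial.aeval A p
  have hAunit : IsUnit A := by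
    by_contra h
    exact hroot 0 le_rfl (Matrix.mem_spectrum_iff_isRoot_charpoly.1 (spectrum.zero_mem ℝ h))
  have hM : IsUnit M.det := by
    rw [← Matrix.isUnit_iff_isUnit_det]
    exact (isUnit_pow_iff two_ne_zero).1 (hp ▸ hAunit)
  refine ⟨M, X * M⁻¹, ?_, ?_, ?_⟩
  · rw [transpose_mul, hKT, mul_neg, hMK]
  · refine SymplecticGroup.mem_iff.1 (SymplecticGroup.mem_iff'.2 ?_)
    calc (X * M⁻¹)ᵀ * K * (X * M⁻¹) = (M⁻¹)ᵀ * (Xᵀ * K * X) * M⁻¹ := by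
          simp only [transpose_mul, mul_assoc]
      _ = (M⁻¹)ᵀ * (Mᵀ * K * M) * M⁻¹ := by rw [← hKA, hMK, ← hp, pow_two, mul_assoc K M M]
      _ = (M * M⁻¹)ᵀ * K * (M * M⁻¹) := by simp only [transpose_mul, mul_assoc]
      _ = K := by simp [Matrix.mul_nonsing_inv M hM]
  · rw [mul_assoc, Matrix.nonsing_inv_mul M hM, mul_one]
end
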